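/- Let n be a natural number, let Π : Fin n → Fin n → ((Fin n → ℝ) → ℝ) be a smooth bivector field on ℝⁿ in coordinates (smooth, antisymmetric in its indices), and let H : Fin n → Fin n → Fin n → ((Fin n → ℝ) → ℝ) be a family of smooth functions totally antisymmetric in its three indices. Then the WZW–Poisson condition (for all i, j, k and all x: Σ_l ( Π i l · ∂_l(Π j k) + Π j l · ∂_l(Π k i) + Π k l · ∂_l(Π i j) )(x) = Σ_{l,m,p} ( Π i l · Π j m · Π k p · H l m p )(x)) holds if and only if for all smooth functions f, g, h : (Fin n → ℝ) → ℝ and all points x one has {f,{g,h}}(x) + {g,{h,f}}(x) + {h,{f,g}}(x) = Σ_{i,j,k,l,m,p} ( Π i l · Π j m · Π k p · H l m p )(x) · ∂_i f(x) · ∂_j g(x) · ∂_k h(x), where {f,g} := Σ_{i,j} (Π i j) · (∂_i f) · (∂_j g). -/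

import Mathlib

/-- Partial derivative of `f : (Fin n → ℝ) → ℝ` along the `i`-th standard
coordinate direction. -/
noncomputable def pderiv' {n : ℕ} (i : Fin n) (f : (Fin n → ℝ) → ℝ)
    (x : Fin n → ℝ) : ℝ :=
  fderiv ℝ f x (Pi.single i 1)

/-- The bracket associated to a bivector field `P` in coordinates:
`{f,g} := Σ_{i,j} P i j · ∂_i f · ∂_j g`. -/
noncomputable def pbracket {n : ℕ} (P : Fin n → Fin n → ((Fin n → ℝ) → ℝ))
    (f g : (Fin n → ℝ) → ℝ) (x : Fin n → ℝ) : ℝ :=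
  ∑ i, ∑ j, P i j x * pderiv' i f x * pderiv' j g x

theorem pderiv'_coord {n : ℕ} (i j : Fin n) (x : Fin n → ℝ) :
    pderiv' i (fun y => y j) x = if i = j then 1 else 0 := by
  rw [pderiv', fderiv_apply differentiableAt_id]
  simp [Pi.single_apply, eq_comm]

theorem contDiff_pderiv' {n : ℕ} {f : (Fin n → ℝ) → ℝ} (hf : ContDiff ℝ (⊤ : ℕ∞) f)
    (i : Fin n) : ContDiff ℝ (⊤ : ℕ∞) (pderiv' i f) :=
  (hf.fderiv_right (m := (⊤ : ℕ∞)) (by exact_mod_cast le_top)).clm_apply contDiff_const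

theorem pderiv'_comm {n : ℕ} {f : (Fin n → ℝ) → ℝ} (hf : ContDiff ℝ (⊤ : ℕ∞) f)
    (i j : Fin n) (x : Fin n → ℝ) :
    pderiv' i (pderiv' j f) x = pderiv' j (pderiv' i f) x := by
  have hd : DifferentiableAt ℝ (fderiv ℝ f) x :=
    (hf.fderiv_right (m := (⊤ : ℕ∞)) (by exact_mod_cast le_top)).differentiable
      (by simp) x
  have key : ∀ a b : Fin n, pderiv' a (pderiv' b f) x
      = fderiv ℝ (fderiv ℝ f) x (Pi.single a 1) (Pi.single b 1) := fun a b => by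
    change fderiv ℝ (fun y => fderiv ℝ f y (Pi.single b 1)) x (Pi.single a 1) = _
    rw [fderiv_clm_apply hd (differentiableAt_const _)]
    simp
  rw [key, key]
  have hle : minSmoothness ℝ 2 ≤ ((⊤ : ℕ∞) : WithTop ℕ∞) := by
    rw [minSmoothness_of_isRCLikeNormedField]
    exact WithTop.coe_le_coe.2 (le_top : (2 : ℕ∞) ≤ ⊤)
  exact (hf.contDiffAt.isSymmSndFDerivAt hle).eq _ _

theorem pderiv'_mul {n : ℕ} {f g : (Fin n → ℝ) → ℝ} {x : Fin n → ℝ}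
    (hf : DifferentiableAt ℝ f x) (hg : DifferentiableAt ℝ g x) (i : Fin n) :
    pderiv' i (fun y => f y * g y) x = pderiv' i f x * g x + f x * pderiv' i g x := by
  simp only [pderiv']
  rw [fderiv_fun_mul hf hg]
  simp
  ring

theorem pderiv'_sum {n : ℕ} {ι : Type*} {s : Finset ι} {f : ι → (Fin n → ℝ) → ℝ}
    {x : Fin n → ℝ} (hf : ∀ a ∈ s, DifferentiableAt ℝ (f a) x) (i : Fin n) :
    pderiv' i (fun y => ∑ a ∈ s, f a y) x = ∑ a ∈ s, pderiv' i (f a) x := by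
  simp only [pderiv']
  rw [fderiv_fun_sum hf]
  simp

theorem pderiv'_pbracket {n : ℕ} {P : Fin n → Fin n → ((Fin n → ℝ) → ℝ)}
    (hP : ∀ i j, ContDiff ℝ (⊤ : ℕ∞) (P i j)) {g h : (Fin n → ℝ) → ℝ}
    (hg : ContDiff ℝ (⊤ : ℕ∞) g) (hh : ContDiff ℝ (⊤ : ℕ∞) h) (l : Fin n) (x : Fin n → ℝ) :
    pderiv' l (pbracket P g h) x = ∑ j, ∑ k,
      (pderiv' l (P j k) x * pderiv' j g x * pderiv' k h x
        + P j k x * pderiv' l (pderiv' j g) x * pderiv' k h x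
        + P j k x * pderiv' j g x * pderiv' l (pderiv' k h) x) := by
  have dP : ∀ j k, DifferentiableAt ℝ (P j k) x := fun j k =>
    (hP j k).differentiable (by simp) x
  have dg : ∀ j, DifferentiableAt ℝ (pderiv' j g) x := fun j =>
    (contDiff_pderiv' hg j).differentiable (by simp) x
  have dh : ∀ j, DifferentiableAt ℝ (pderiv' j h) x := fun j =>
    (contDiff_pderiv' hh j).differentiable (by simp) x
  have dPg : ∀ j k, DifferentiableAt ℝ (fun y => P j k y * pderiv' j g y) x := fun j k =>
    (dP j k).mul (dg j)
  have dPgh : ∀ j k, DifferentiableAt ℝ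
      (fun y => P j k y * pderiv' j g y * pderiv' k h y) x := fun j k => (dPg j k).mul (dh k)
  change pderiv' l (fun y => ∑ j, ∑ k, P j k y * pderiv' j g y * pderiv' k h y) x = _
  rw [pderiv'_sum fun j _ => DifferentiableAt.fun_sum fun k _ => dPgh j k]
  refine Finset.sum_congr rfl fun j _ => ?_
  rw [pderiv'_sum fun k _ => dPgh j k]
  refine Finset.sum_congr rfl fun k _ => ?_
  rw [pderiv'_mul (dPg j k) (dh k), pderiv'_mul (dP j k) (dg j)]
  ring

/-- The contraction `∑ uᵢ Aᵢₗ Bₗⱼ Aⱼₖ vₖ`, for `B` the Hessian of a function in practice. -/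
def sandwich {n : ℕ} (A B : Fin n → Fin n → ℝ) (u v : Fin n → ℝ) : ℝ :=
  ∑ i, ∑ l, ∑ j, ∑ k, u i * A i l * B l j * A j k * v k

theorem sandwich_comm {n : ℕ} {A B : Fin n → Fin n → ℝ} (hA : ∀ i j, A i j = -A j i)
    (hB : ∀ i j, B i j = B j i) (u v : Fin n → ℝ) : sandwich A B u v = sandwich A B v u := by
  have reverse : ∀ F : Fin n → Fin n → Fin n → Fin n → ℝ,
      ∑ i, ∑ l, ∑ j, ∑ k, F i l j k = ∑ i, ∑ l, ∑ j, ∑ k, F k j l i := fun F => by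
    simp only [← Fintype.sum_prod_type']
    let e : Fin n × Fin n × Fin n × Fin n → Fin n × Fin n × Fin n × Fin n :=
      fun p => (p.2.2.2, p.2.2.1, p.2.1, p.1)
    exact Fintype.sum_equiv ⟨e, e, fun _ => rfl, fun _ => rfl⟩ _ _ fun _ => rfl
  unfold sandwich
  rw [reverse]
  refine Finset.sum_congr rfl fun i _ => Finset.sum_congr rfl fun l _ =>
    Finset.sum_congr rfl fun j _ => Finset.sum_congr rfl fun k _ => ?_
  rw [hA k j, hA l i, hB j l]
  ring

theorem pbracket_pbracket {n : ℕ} {P : Fin n → Fin n → ((Fin n → ℝ) → ℝ)}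
    (hP : ∀ i j, ContDiff ℝ (⊤ : ℕ∞) (P i j)) (hPanti : ∀ i j x, P i j x = -P j i x)
    {f g h : (Fin n → ℝ) → ℝ}
    (hg : ContDiff ℝ (⊤ : ℕ∞) g) (hh : ContDiff ℝ (⊤ : ℕ∞) h) (x : Fin n → ℝ) :
    pbracket P f (pbracket P g h) x =
      ∑ i, ∑ j, ∑ k, (∑ l, P i l x * pderiv' l (P j k) x)
          * pderiv' i f x * pderiv' j g x * pderiv' k h x
        + sandwich (fun i j => P i j x) (fun i j => pderiv' i (pderiv' j g) x)
            (fun i => pderiv' i f x) (fun i => pderiv' i h x)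
        - sandwich (fun i j => P i j x) (fun i j => pderiv' i (pderiv' j h) x)
            (fun i => pderiv' i f x) (fun i => pderiv' i g x) := by
  have hfirst : ∑ i, ∑ j, ∑ k, (∑ l, P i l x * pderiv' l (P j k) x)
          * pderiv' i f x * pderiv' j g x * pderiv' k h x
      = ∑ i, ∑ l, ∑ j, ∑ k, P i l x * pderiv' l (P j k) x
          * pderiv' i f x * pderiv' j g x * pderiv' k h x := by
    refine Finset.sum_congr rfl fun i _ => ?_
    simp only [Finset.sum_mul]
    rw [Finset.sum_comm]
    conv_rhs => rw [Finset.sum_comm]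
    rw [Finset.sum_comm]
    exact Finset.sum_congr rfl fun j _ => Finset.sum_comm
  have hlast : sandwich (fun i j => P i j x) (fun i j => pderiv' i (pderiv' j h) x)
            (fun i => pderiv' i f x) (fun i => pderiv' i g x)
      = ∑ i, ∑ l, ∑ j, ∑ k, pderiv' i f x * P i l x * pderiv' l (pderiv' k h) x
          * P k j x * pderiv' j g x := by
    refine Finset.sum_congr rfl fun i _ => Finset.sum_congr rfl fun l _ => ?_
    exact Finset.sum_comm
  rw [hfirst, hlast]
  simp only [sandwich, pbracket.eq_1 P f, pderiv'_pbracket hP hg hh, Finset.mul_sum,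
    ← Finset.sum_add_distrib, ← Finset.sum_sub_distrib]
  refine Finset.sum_congr rfl fun i _ => Finset.sum_congr rfl fun l _ =>
    Finset.sum_congr rfl fun j _ => Finset.sum_congr rfl fun k _ => ?_
  rw [hPanti k j]
  ring

theorem sum_rotate {ι M : Type*} [Fintype ι] [AddCommMonoid M] (F : ι → ι → ι → M) :
    ∑ i, ∑ j, ∑ k, F i j k = ∑ i, ∑ j, ∑ k, F j k i := by
  conv_rhs => rw [Finset.sum_comm]
  exact Finset.sum_congr rfl fun i _ => Finset.sum_comm

/-- The second derivatives of the arguments cancel in the Jacobiator. -/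
theorem jacobiator_eq {n : ℕ} {P : Fin n → Fin n → ((Fin n → ℝ) → ℝ)}
    (hP : ∀ i j, ContDiff ℝ (⊤ : ℕ∞) (P i j)) (hPanti : ∀ i j x, P i j x = -P j i x)
    {f g h : (Fin n → ℝ) → ℝ} (hf : ContDiff ℝ (⊤ : ℕ∞) f)
    (hg : ContDiff ℝ (⊤ : ℕ∞) g) (hh : ContDiff ℝ (⊤ : ℕ∞) h) (x : Fin n → ℝ) :
    pbracket P f (pbracket P g h) x + pbracket P g (pbracket P h f) x
        + pbracket P h (pbracket P f g) x
      = ∑ i, ∑ j, ∑ k, (∑ l, (P i l x * pderiv' l (P j k) x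
           + P j l x * pderiv' l (P k i) x
           + P k l x * pderiv' l (P i j) x))
          * pderiv' i f x * pderiv' j g x * pderiv' k h x := by
  have hsplit : ∑ i, ∑ j, ∑ k, (∑ l, (P i l x * pderiv' l (P j k) x
           + P j l x * pderiv' l (P k i) x
           + P k l x * pderiv' l (P i j) x))
          * pderiv' i f x * pderiv' j g x * pderiv' k h x
      = ∑ i, ∑ j, ∑ k, (∑ l, P i l x * pderiv' l (P j k) x)
          * pderiv' i f x * pderiv' j g x * pderiv' k h x
        + ∑ i, ∑ j, ∑ k, (∑ l, P i l x * pderiv' l (P j k) x)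
          * pderiv' i g x * pderiv' j h x * pderiv' k f x
        + ∑ i, ∑ j, ∑ k, (∑ l, P i l x * pderiv' l (P j k) x)
          * pderiv' i h x * pderiv' j f x * pderiv' k g x := by
    rw [sum_rotate fun i j k => (∑ l, P i l x * pderiv' l (P j k) x)
          * pderiv' i g x * pderiv' j h x * pderiv' k f x,
      sum_rotate fun i j k => (∑ l, P i l x * pderiv' l (P j k) x)
          * pderiv' i h x * pderiv' j f x * pderiv' k g x,
      sum_rotate fun i j k => (∑ l, P j l x * pderiv' l (P k i) x)
          * pderiv' j h x * pderiv' k f x * pderiv' i g x]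
    simp only [← Finset.sum_add_distrib]
    refine Finset.sum_congr rfl fun i _ => Finset.sum_congr rfl fun j _ =>
      Finset.sum_congr rfl fun k _ => ?_
    simp only [Finset.sum_add_distrib]
    ring
  rw [hsplit, pbracket_pbracket hP hPanti hg hh, pbracket_pbracket hP hPanti hh hf,
    pbracket_pbracket hP hPanti hf hg]
  have hA : ∀ i j, P i j x = -P j i x := fun i j => hPanti i j x
  rw [sandwich_comm hA (fun i j => pderiv'_comm hf i j x) (fun i => pderiv' i h x),
    sandwich_comm hA (fun i j => pderiv'_comm hg i j x) (fun i => pderiv' i h x),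
    sandwich_comm hA (fun i j => pderiv'_comm hh i j x) (fun i => pderiv' i g x)]
  ring

theorem wzw_poisson_iff_twisted_jacobi {n : ℕ}
    (P : Fin n → Fin n → ((Fin n → ℝ) → ℝ))
    (H : Fin n → Fin n → Fin n → ((Fin n → ℝ) → ℝ))
    (hPsmooth : ∀ i j, ContDiff ℝ (⊤ : ℕ∞) (P i j))
    (hPanti : ∀ i j, P i j = fun x => -P j i x)
    (hHsmooth : ∀ i j k, ContDiff ℝ (⊤ : ℕ∞) (H i j k))
    (hHanti₁ : ∀ i j k, H i j k = fun x => -H j i k x)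
    (hHanti₂ : ∀ i j k, H i j k = fun x => -H i k j x) :
    (∀ i j k, ∀ x : Fin n → ℝ,
      (∑ l, (P i l x * pderiv' l (P j k) x
           + P j l x * pderiv' l (P k i) x
           + P k l x * pderiv' l (P i j) x))
      = ∑ l, ∑ m, ∑ p, P i l x * P j m x * P k p x * H l m p x)
    ↔
    (∀ f g h : (Fin n → ℝ) → ℝ, ContDiff ℝ (⊤ : ℕ∞) f → ContDiff ℝ (⊤ : ℕ∞) g →
      ContDiff ℝ (⊤ : ℕ∞) h → ∀ x : Fin n → ℝ,
      pbracket P f (pbracket P g h) x + pbracket P g (pbracket P h f) x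
        + pbracket P h (pbracket P f g) x
      = ∑ i, ∑ j, ∑ k, ∑ l, ∑ m, ∑ p,
          (P i l x * P j m x * P k p x * H l m p x)
          * pderiv' i f x * pderiv' j g x * pderiv' k h x) := by
  have hPa : ∀ i j x, P i j x = -P j i x := fun i j x => congrFun (hPanti i j) x
  constructor
  · intro hW f g h hf hg hh x
    rw [jacobiator_eq hPsmooth hPa hf hg hh]
    simp only [hW, Finset.sum_mul]
  · intro hJ i j k x
    have hc : ∀ a : Fin n, ContDiff ℝ (⊤ : ℕ∞) (fun y : Fin n → ℝ => y a) := fun a =>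
      contDiff_apply ℝ ℝ a
    have h := hJ _ _ _ (hc i) (hc j) (hc k) x
    rw [jacobiator_eq hPsmooth hPa (hc i) (hc j) (hc k)] at h
    simpa only [← Finset.sum_mul, pderiv'_coord, mul_ite, mul_one, mul_zero, ite_mul, zero_mul,
      Finset.sum_ite_eq', Finset.mem_univ, if_true, Finset.sum_ite_irrel,
      Finset.sum_const_zero] using h
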